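/- arXiv:1101.4492 — 2 statements merged into one kernel-verified Lean document; each statement's English description precedes it below -/
import Mathlib

section
/- Let G be a finite abelian group of odd order and let S be a sequence over G with 0 not a term of S, |S| ≥ D(G) − 1, and N_0(S) = 2^{|S|−D(G)+1}. Then S contains exactly |S| − D(G) + 1 minimal zero-sum subsequences, and these are pairwise disjoint (any two distinct ones have empty multiset intersection). -/
/-- `NSub S g` is the number of subsequences (sub-multisets, counted with the
multiplicity of their appearance in `S`) of the sequence `S` with sum `g`. -/
def NSub {G : Type*} [AddCommGroup G] [DecidableEq G] (S : Multiset G) (g : G) : ℕ :=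
  (S.powerset.filter (fun T => T.sum = g)).card

/-- The Davenport constant of `G`: the smallest positive integer `ℓ` such that every
sequence over `G` of length at least `ℓ` has a nonempty zero-sum subsequence. -/
noncomputable def Davenport (G : Type*) [AddCommGroup G] : ℕ :=
  sInf {ℓ : ℕ | 0 < ℓ ∧ ∀ S : Multiset G, ℓ ≤ Multiset.card S →
    ∃ T : Multiset G, T ≤ S ∧ T ≠ 0 ∧ T.sum = 0}

/-- `ESet S = {g ∈ G : N_g(S) = 2 ^ (|S| - D(G) + 1)}`. -/
def ESet {G : Type*} [AddCommGroup G] [DecidableEq G] (S : Multiset G) : Set G :=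
  {g | NSub S g = 2 ^ (Multiset.card S + 1 - Davenport G)}

/-- A minimal zero-sum sequence: nonempty, zero-sum, and every nonempty proper
subsequence has nonzero sum. -/
def IsMinZeroSum {G : Type*} [AddCommGroup G] (T : Multiset G) : Prop :=
  T ≠ 0 ∧ T.sum = 0 ∧ ∀ U : Multiset G, U ≤ T → U ≠ 0 → U ≠ T → U.sum ≠ 0

/-- The subsets `t` of `s` with `∑ i ∈ t, f i = g`. -/
def sumFiber {ι G : Type*} [AddCommGroup G] [DecidableEq G] (f : ι → G) (s : Finset ι) (g : G) :
    Finset (Finset ι) :=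
  s.powerset.filter fun t => ∑ i ∈ t, f i = g

/-- A minimal nonempty index set with zero sum. -/
def IsMinZeroIndex {ι G : Type*} [AddCommGroup G] (f : ι → G) (t : Finset ι) : Prop :=
  t.Nonempty ∧ ∑ i ∈ t, f i = 0 ∧ ∀ u ⊆ t, u.Nonempty → ∑ i ∈ u, f i = 0 → u = t

open Classical in
/-- The minimal zero-sum index sets contained in `s`. -/
noncomputable def minZeroIndices {ι G : Type*} [AddCommGroup G] (f : ι → G) (s : Finset ι) :
    Finset (Finset ι) :=
  s.powerset.filter (IsMinZeroIndex f)

theorem Multiset.powerset_map_eq {α β : Type*} (f : α → β) (s : Multiset α) :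
    (s.map f).powerset = s.powerset.map (Multiset.map f) := by
  induction s using Multiset.induction_on with
  | empty => simp
  | cons a s ih => simp [Multiset.powerset_cons, ih, Multiset.map_map]

theorem Finset.exists_subset_map_eq {α β : Type*} {f : α → β} {s : Finset α} {T : Multiset β}
    (h : T ≤ s.val.map f) : ∃ t ⊆ s, t.val.map f = T := by
  rw [← Multiset.mem_powerset, Multiset.powerset_map_eq, Multiset.mem_map] at h
  obtain ⟨u, hu, rfl⟩ := h
  rw [Multiset.mem_powerset] at hu
  exact ⟨⟨u, Multiset.nodup_of_le hu s.nodup⟩, Finset.val_le_iff.1 hu, rfl⟩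

theorem exists_zero_sum_of_card_le {G : Type*} [AddCommGroup G] [Fintype G] (S : Multiset G)
    (h : Fintype.card G ≤ Multiset.card S) : ∃ T ≤ S, T ≠ 0 ∧ T.sum = 0 := by
  induction S using Quotient.inductionOn with
  | h l =>
  have hl : Fintype.card G ≤ l.length := h
  obtain ⟨i, j, hij, he⟩ := Fintype.exists_ne_map_eq_of_card_lt
    (fun k : Fin (Fintype.card G + 1) => (l.take k).sum) (by simp)
  wlog hlt : i < j generalizing i j
  · exact this j i hij.symm he.symm (lt_of_le_of_ne (not_lt.1 hlt) hij.symm)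
  have hltn : (i : ℕ) < j := hlt
  refine ⟨((l.take j).drop i : List G), ?_, ?_, ?_⟩
  · exact ((List.drop_sublist _ _).trans (List.take_sublist _ _)).subperm
  · intro h0
    have := congrArg Multiset.card h0
    simp at this
    omega
  · have h1 := List.sum_take_add_sum_drop (l.take j) i
    rw [List.take_take, min_eq_left hltn.le] at h1
    rw [he] at h1
    simpa using h1

theorem davenport_spec (G : Type*) [AddCommGroup G] [Fintype G] :
    0 < Davenport G ∧ ∀ S : Multiset G, Davenport G ≤ Multiset.card S →
      ∃ T : Multiset G, T ≤ S ∧ T ≠ 0 ∧ T.sum = 0 :=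
  Nat.sInf_mem (s := {ℓ : ℕ | 0 < ℓ ∧ ∀ S : Multiset G, ℓ ≤ Multiset.card S →
    ∃ T : Multiset G, T ≤ S ∧ T ≠ 0 ∧ T.sum = 0})
    ⟨Fintype.card G, Fintype.card_pos, fun S hS => exists_zero_sum_of_card_le S hS⟩

section Index

variable {ι G : Type*} [DecidableEq ι] [AddCommGroup G] [DecidableEq G]

omit [DecidableEq ι] in
theorem mem_sumFiber {f : ι → G} {s t : Finset ι} {g : G} :
    t ∈ sumFiber f s g ↔ t ⊆ s ∧ ∑ i ∈ t, f i = g := by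
  simp [sumFiber]

omit [DecidableEq ι] [DecidableEq G] in
theorem mem_minZeroIndices {f : ι → G} {s t : Finset ι} :
    t ∈ minZeroIndices f s ↔ t ⊆ s ∧ IsMinZeroIndex f t := by
  simp [minZeroIndices]

omit [DecidableEq ι] [DecidableEq G] in
theorem exists_zero_sum_index [Fintype G] (f : ι → G) (s : Finset ι) (h : Davenport G ≤ s.card) :
    ∃ t ⊆ s, t.Nonempty ∧ ∑ i ∈ t, f i = 0 := by
  obtain ⟨T, hT, hne, h0⟩ := (davenport_spec G).2 (s.val.map f) (by simpa using h)
  obtain ⟨t, ht, rfl⟩ := Finset.exists_subset_map_eq hT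
  exact ⟨t, ht, by rw [Finset.nonempty_iff_ne_empty]; rintro rfl; simp at hne, h0⟩

theorem card_sumFiber_erase (f : ι → G) {s : Finset ι} {a : ι} (ha : a ∈ s) (g : G) :
    (sumFiber f s g).card =
      (sumFiber f (s.erase a) g).card + (sumFiber f (s.erase a) (g - f a)).card := by
  have hn : ∀ t ∈ sumFiber f (s.erase a) (g - f a), a ∉ t := fun t ht h =>
    Finset.notMem_erase a s ((mem_sumFiber.1 ht).1 h)
  have e : sumFiber f s g = sumFiber f (s.erase a) g ∪
      (sumFiber f (s.erase a) (g - f a)).image (insert a) := by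
    ext t
    simp only [Finset.mem_union, Finset.mem_image, mem_sumFiber]
    constructor
    · rintro ⟨h1, h2⟩
      by_cases hat : a ∈ t
      · right
        refine ⟨t.erase a, ⟨Finset.erase_subset_erase a h1, ?_⟩, Finset.insert_erase hat⟩
        rw [← h2, ← Finset.add_sum_erase t f hat]
        abel
      · exact Or.inl ⟨Finset.subset_erase.2 ⟨h1, hat⟩, h2⟩
    · rintro (⟨h1, h2⟩ | ⟨u, ⟨h1, h2⟩, rfl⟩)
      · exact ⟨h1.trans (Finset.erase_subset _ _), h2⟩
      · refine ⟨Finset.insert_subset ha (h1.trans (Finset.erase_subset _ _)), ?_⟩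
        rw [Finset.sum_insert (fun h => Finset.notMem_erase a s (h1 h)), h2]
        abel
  rw [e, Finset.card_union_of_disjoint, Finset.card_image_of_injOn]
  · intro t ht u hu h
    rw [← Finset.erase_insert (hn t ht), ← Finset.erase_insert (hn u hu), h]
  · rw [Finset.disjoint_left]
    rintro t ht h
    obtain ⟨u, -, rfl⟩ := Finset.mem_image.1 h
    exact Finset.notMem_erase a s ((mem_sumFiber.1 ht).1 (Finset.mem_insert_self a u))

omit [DecidableEq G] in
theorem Finset.sum_sdiff_add_sum_inter (s t : Finset ι) (f : ι → G) :
    ∑ i ∈ s \ t, f i + ∑ i ∈ s ∩ t, f i = ∑ i ∈ s, f i := by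
  rw [add_comm, Finset.sum_inter_add_sum_sdiff]

omit [DecidableEq G] in
theorem sum_symmDiff_neg_on (f : ι → G) (t u : Finset ι) :
    ∑ i ∈ symmDiff u t, f i =
      ∑ i ∈ u, (if i ∈ t then -f i else f i) + ∑ i ∈ t, f i := by
  have h1 : ∑ i ∈ u, (if i ∈ t then -f i else f i) = ∑ i ∈ u \ t, f i - ∑ i ∈ u ∩ t, f i := by
    rw [← Finset.sum_sdiff_add_sum_inter u t, sub_eq_add_neg, ← Finset.sum_neg_distrib]
    congr 1
    · exact Finset.sum_congr rfl fun i hi => by rw [if_neg (Finset.mem_sdiff.1 hi).2]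
    · exact Finset.sum_congr rfl fun i hi => by rw [if_pos (Finset.mem_inter.1 hi).2]
  have h2 : ∑ i ∈ t, f i = ∑ i ∈ t \ u, f i + ∑ i ∈ u ∩ t, f i := by
    rw [Finset.inter_comm, Finset.sum_sdiff_add_sum_inter]
  have h3 : ∑ i ∈ symmDiff u t, f i = ∑ i ∈ u \ t, f i + ∑ i ∈ t \ u, f i := by
    rw [symmDiff_def, Finset.sup_eq_union, Finset.sum_union]
    exact disjoint_sdiff_sdiff
  rw [h1, h2, h3]
  abel

/-- Negating the terms indexed by a set with sum `g` turns zero-sum sets into sets of sum `g`. -/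
theorem card_sumFiber_neg_on_le (f : ι → G) {s t : Finset ι} (ht : t ⊆ s) :
    (sumFiber (fun i => if i ∈ t then -f i else f i) s 0).card ≤
      (sumFiber f s (∑ i ∈ t, f i)).card := by
  refine Finset.card_le_card_of_injOn (fun u => symmDiff u t) ?_ ?_
  · intro u hu
    obtain ⟨h1, h2⟩ := mem_sumFiber.1 hu
    refine Finset.mem_coe.2 (mem_sumFiber.2 ⟨?_, ?_⟩)
    · exact symmDiff_le_sup.trans (Finset.union_subset h1 ht)
    · rw [sum_symmDiff_neg_on, h2, zero_add]
  · intro u _ v _ h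
    exact symmDiff_left_injective t h

theorem two_pow_le_card_sumFiber_zero [Fintype G] (n : ℕ) :
    ∀ (s : Finset ι) (f : ι → G), s.card = n →
      2 ^ (n + 1 - Davenport G) ≤ (sumFiber f s 0).card := by
  induction n with
  | zero =>
    intro s f _
    have := (davenport_spec G).1
    rw [show 0 + 1 - Davenport G = 0 by omega, pow_zero, Nat.one_le_iff_ne_zero,
      ← Nat.pos_iff_ne_zero, Finset.card_pos]
    exact ⟨∅, mem_sumFiber.2 ⟨by simp, by simp⟩⟩
  | succ n ih =>
    intro s f hs
    by_cases hD : Davenport G ≤ n + 1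
    · obtain ⟨t, ht, ⟨a, ha⟩, h0⟩ := exists_zero_sum_index f s (hs ▸ hD)
      have hc : (s.erase a).card = n := by rw [Finset.card_erase_of_mem (ht ha), hs]; rfl
      have hsub : t.erase a ⊆ s.erase a := Finset.erase_subset_erase a ht
      have hsum : ∑ i ∈ t.erase a, f i = 0 - f a := by
        rw [← h0, ← Finset.add_sum_erase t f ha]
        abel
      have h1 := ih (s.erase a) f hc
      have h2 := (ih (s.erase a) _ hc).trans (card_sumFiber_neg_on_le f hsub)
      rw [hsum] at h2
      rw [card_sumFiber_erase f (ht ha), show n + 1 + 1 - Davenport G = n + 1 - Davenport G + 1 by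
        omega, pow_succ]
      omega
    · rw [show n + 1 + 1 - Davenport G = 0 by omega, pow_zero, Nat.one_le_iff_ne_zero,
        ← Nat.pos_iff_ne_zero, Finset.card_pos]
      exact ⟨∅, mem_sumFiber.2 ⟨by simp, by simp⟩⟩

theorem two_pow_le_card_sumFiber [Fintype G] (s t : Finset ι) (f : ι → G) (ht : t ⊆ s) :
    2 ^ (s.card + 1 - Davenport G) ≤ (sumFiber f s (∑ i ∈ t, f i)).card :=
  (two_pow_le_card_sumFiber_zero _ s _ rfl).trans (card_sumFiber_neg_on_le f ht)

/-- `s` attains the lower bound `2 ^ m` for the number of its zero-sum subsets. -/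
def IsTight (f : ι → G) (s : Finset ι) (m : ℕ) : Prop :=
  s.card + 1 = Davenport G + m ∧ (sumFiber f s 0).card = 2 ^ m

theorem IsTight.erase [Fintype G] {f : ι → G} {s t : Finset ι} {m : ℕ} (h : IsTight f s (m + 1))
    {a : ι} (ha : a ∈ t) (ht : t ⊆ s) (h0 : ∑ i ∈ t, f i = 0) : IsTight f (s.erase a) m := by
  obtain ⟨h1, h2⟩ := h
  have hc : (s.erase a).card + 1 = Davenport G + m := by
    rw [Finset.card_erase_add_one (ht ha)]; omega
  have hsum : ∑ i ∈ t.erase a, f i = 0 - f a := by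
    rw [← h0, ← Finset.add_sum_erase t f ha]
    abel
  have h3 := two_pow_le_card_sumFiber (s.erase a) ∅ f (by simp)
  have h4 := two_pow_le_card_sumFiber (s.erase a) _ f (Finset.erase_subset_erase a ht)
  rw [hsum] at h4
  rw [show (s.erase a).card + 1 - Davenport G = m by omega] at h3 h4
  rw [card_sumFiber_erase f (ht ha), pow_succ] at h2
  rw [Finset.sum_empty] at h3
  exact ⟨hc, by omega⟩

omit [DecidableEq G] in
theorem exists_isMinZeroIndex_mem {f : ι → G} {t : Finset ι} (h0 : ∑ i ∈ t, f i = 0) {a : ι}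
    (ha : a ∈ t) : ∃ u ⊆ t, a ∈ u ∧ IsMinZeroIndex f u := by
  induction t using Finset.strongInduction with
  | H t ih =>
  by_cases hm : IsMinZeroIndex f t
  · exact ⟨t, subset_rfl, ha, hm⟩
  · have : ∃ u ⊆ t, u.Nonempty ∧ ∑ i ∈ u, f i = 0 ∧ u ≠ t := by
      by_contra! hc
      exact hm ⟨⟨a, ha⟩, h0, hc⟩
    obtain ⟨u, hu, hne, hu0, hut⟩ := this
    by_cases hau : a ∈ u
    · obtain ⟨v, hv, hav, hvm⟩ := ih u (hu.ssubset_of_ne hut) hu0 hau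
      exact ⟨v, hv.trans hu, hav, hvm⟩
    · have hd0 : ∑ i ∈ t \ u, f i = 0 := by
        have := Finset.sum_sdiff (f := f) hu
        rwa [hu0, h0, add_zero] at this
      obtain ⟨v, hv, hav, hvm⟩ := ih (t \ u) (Finset.sdiff_ssubset hu hne) hd0
        (Finset.mem_sdiff.2 ⟨ha, hau⟩)
      exact ⟨v, hv.trans Finset.sdiff_subset, hav, hvm⟩

omit [DecidableEq ι] [DecidableEq G] in
theorem IsMinZeroIndex.eq_of_subset {f : ι → G} {t u : Finset ι} (ht : IsMinZeroIndex f t)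
    (hu : IsMinZeroIndex f u) (h : u ⊆ t) : u = t :=
  ht.2.2 u h hu.1 hu.2.1

omit [DecidableEq G] in
theorem mem_minZeroIndices_erase {f : ι → G} {s t : Finset ι} {a : ι} :
    t ∈ minZeroIndices f (s.erase a) ↔ t ∈ minZeroIndices f s ∧ a ∉ t := by
  simp only [mem_minZeroIndices, Finset.subset_erase]
  tauto

omit [DecidableEq ι] in
theorem empty_mem_sumFiber (f : ι → G) (s : Finset ι) : ∅ ∈ sumFiber f s 0 :=
  mem_sumFiber.2 ⟨by simp, by simp⟩

omit [DecidableEq ι] in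
theorem mem_sumFiber_of_mem_minZeroIndices {f : ι → G} {s t : Finset ι}
    (h : t ∈ minZeroIndices f s) : t ∈ sumFiber f s 0 :=
  mem_sumFiber.2 ⟨(mem_minZeroIndices.1 h).1, (mem_minZeroIndices.1 h).2.2.1⟩

theorem mem_sumFiber_erase {f : ι → G} {s t : Finset ι} {a : ι} {g : G} :
    t ∈ sumFiber f (s.erase a) g ↔ t ∈ sumFiber f s g ∧ a ∉ t := by
  simp only [mem_sumFiber, Finset.subset_erase]
  tauto

omit [DecidableEq ι] [DecidableEq G] in
theorem eq_zero_of_add_self_eq_zero [Fintype G] (hodd : Odd (Fintype.card G)) {g : G}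
    (h : g + g = 0) : g = 0 := by
  have h2 : addOrderOf g ∣ 2 := addOrderOf_dvd_of_nsmul_eq_zero (by rw [two_nsmul, h])
  have h3 : addOrderOf g ∣ Fintype.card G := addOrderOf_dvd_card
  have hc : Nat.Coprime 2 (Fintype.card G) := Nat.coprime_two_left.2 hodd
  exact AddMonoid.addOrderOf_eq_one_iff.1 (Nat.eq_one_of_dvd_coprimes hc h2 h3)

theorem three_le_card {α : Type*} [DecidableEq α] {A : Finset α} {x y z : α} (hx : x ∈ A)
    (hy : y ∈ A) (hz : z ∈ A) (hxy : x ≠ y) (hxz : x ≠ z) (hyz : y ≠ z) : 3 ≤ A.card := by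
  rw [← Finset.card_eq_three.2 ⟨x, y, z, hxy, hxz, hyz, rfl⟩]
  exact Finset.card_le_card (by grind)

/-- With exactly four zero-sum sets, two minimal ones cannot overlap in odd order. -/
theorem disjoint_of_isTight_two [Fintype G] (hodd : Odd (Fintype.card G)) {f : ι → G}
    {s V W : Finset ι} (h : IsTight f s 2) (hV : V ∈ minZeroIndices f s)
    (hW : W ∈ minZeroIndices f s) (hVW : V ≠ W) : Disjoint V W := by
  rw [Finset.disjoint_left]
  intro a haV haW
  have hVs := (mem_minZeroIndices.1 hV).1
  have hWs := (mem_minZeroIndices.1 hW).1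
  have hVm := (mem_minZeroIndices.1 hV).2
  have hWm := (mem_minZeroIndices.1 hW).2
  have hVz := mem_sumFiber_of_mem_minZeroIndices hV
  have hWz := mem_sumFiber_of_mem_minZeroIndices hW
  have hcard : ∀ t ∈ sumFiber f s 0, ∀ x ∈ t, (sumFiber f (s.erase x) 0).card = 2 :=
    fun t ht x hx => (h.erase hx (mem_sumFiber.1 ht).1 (mem_sumFiber.1 ht).2).2
  have hother : ∀ t ∈ sumFiber f s 0, ∀ x ∈ t, ∃ T ∈ sumFiber f s 0, T ≠ ∅ ∧ x ∉ T := by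
    intro t ht x hx
    obtain ⟨T, hT, hne⟩ := Finset.exists_mem_ne (by rw [hcard t ht x hx]; omega)
      (∅ : Finset ι)
    exact ⟨T, (mem_sumFiber_erase.1 hT).1, hne, (mem_sumFiber_erase.1 hT).2⟩
  have hnot3 : ∀ t ∈ sumFiber f s 0, ∀ x ∈ t, ∀ P ∈ sumFiber f s 0, ∀ Q ∈ sumFiber f s 0,
      P ≠ ∅ → Q ≠ ∅ → P ≠ Q → x ∉ P → x ∈ Q := by
    intro t ht x hx P hP Q hQ hP0 hQ0 hPQ hxP
    by_contra hxQ
    have := three_le_card (mem_sumFiber_erase.2 ⟨empty_mem_sumFiber f s, by simp⟩)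
      (mem_sumFiber_erase.2 ⟨hP, hxP⟩) (mem_sumFiber_erase.2 ⟨hQ, hxQ⟩) hP0.symm hQ0.symm hPQ
    rw [hcard t ht x hx] at this
    omega
  obtain ⟨T, hT, hT0, haT⟩ := hother V hVz a haV
  have hV0 : V ≠ ∅ := hVm.1.ne_empty
  have hW0 : W ≠ ∅ := hWm.1.ne_empty
  have hTV : T ≠ V := fun e => haT (e ▸ haV)
  have hTW : T ≠ W := fun e => haT (e ▸ haW)
  have hall : ∀ R ∈ sumFiber f s 0, R = ∅ ∨ R = T ∨ R = V ∨ R = W := by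
    have hsub : ({∅, T, V, W} : Finset (Finset ι)) ⊆ sumFiber f s 0 := by
      intro R hR
      simp only [Finset.mem_insert, Finset.mem_singleton] at hR
      rcases hR with rfl | rfl | rfl | rfl
      exacts [empty_mem_sumFiber f s, hT, hVz, hWz]
    have hc4 : ({∅, T, V, W} : Finset (Finset ι)).card = 4 :=
      Finset.card_eq_four.2 ⟨∅, T, V, W, hT0.symm, hV0.symm, hW0.symm, hTV, hTW, hVW, rfl⟩
    have heq := Finset.eq_of_subset_of_card_le hsub (by rw [h.2, hc4]; norm_num)
    intro R hR
    rw [← heq] at hR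
    simpa using hR
  have hTeq : T = symmDiff V W := by
    ext x
    rw [Finset.mem_symmDiff]
    constructor
    · intro hx
      by_cases hxV : x ∈ V
      · refine Or.inl ⟨hxV, fun hxW => ?_⟩
        obtain ⟨R, hR, hR0, hxR⟩ := hother T hT x hx
        rcases hall R hR with rfl | rfl | rfl | rfl
        exacts [hR0 rfl, hxR hx, hxR hxV, hxR hxW]
      · exact Or.inr ⟨hnot3 T hT x hx V hVz W hWz hV0 hW0 hVW hxV, hxV⟩
    · rintro (⟨hxV, hxW⟩ | ⟨hxW, hxV⟩)
      · exact hnot3 V hVz x hxV W hWz T hT hW0 hT0 hTW.symm hxW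
      · exact hnot3 W hWz x hxW V hVz T hT hV0 hT0 hTV.symm hxV
  have e1 : ∑ i ∈ V \ W, f i + ∑ i ∈ V ∩ W, f i = 0 := by
    rw [Finset.sum_sdiff_add_sum_inter, hVm.2.1]
  have e2 : ∑ i ∈ W \ V, f i + ∑ i ∈ V ∩ W, f i = 0 := by
    rw [Finset.inter_comm, Finset.sum_sdiff_add_sum_inter, hWm.2.1]
  have e3 : ∑ i ∈ V \ W, f i + ∑ i ∈ W \ V, f i = 0 := by
    rw [← (mem_sumFiber.1 hT).2, hTeq, symmDiff_def, Finset.sup_eq_union, Finset.sum_union]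
    exact disjoint_sdiff_sdiff
  have e4 : ∑ i ∈ V ∩ W, f i = 0 := by
    apply eq_zero_of_add_self_eq_zero hodd
    rw [eq_neg_of_add_eq_zero_left e1, eq_neg_of_add_eq_zero_left e2] at e3
    rw [← neg_eq_zero, neg_add, e3]
  have hne : (V ∩ W).Nonempty := ⟨a, Finset.mem_inter.2 ⟨haV, haW⟩⟩
  exact hVW ((hVm.2.2 _ Finset.inter_subset_left hne e4).symm.trans
    (hWm.2.2 _ Finset.inter_subset_right hne e4))

theorem card_minZeroIndices_of_isTight [Fintype G] (hodd : Odd (Fintype.card G)) (f : ι → G)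
    (m : ℕ) : ∀ s : Finset ι, IsTight f s m → (minZeroIndices f s).card = m ∧
      (minZeroIndices f s : Set (Finset ι)).Pairwise Disjoint := by
  induction m with
  | zero =>
    intro s hs
    have he : minZeroIndices f s = ∅ := by
      rw [Finset.eq_empty_iff_forall_notMem]
      intro t ht
      have h1 := Finset.card_le_one.1 (le_of_eq hs.2) t (mem_sumFiber_of_mem_minZeroIndices ht) ∅
        (empty_mem_sumFiber f s)
      exact (mem_minZeroIndices.1 ht).2.1.ne_empty h1
    simp [he]
  | succ m ih =>
    intro s hs
    have hdisj : (minZeroIndices f s : Set (Finset ι)).Pairwise Disjoint := by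
      intro V hV W hW hVW
      rw [Finset.mem_coe] at hV hW
      have hVm := (mem_minZeroIndices.1 hV).2
      have hWm := (mem_minZeroIndices.1 hW).2
      rcases Nat.lt_or_ge m 2 with hm | hm
      · obtain rfl | rfl : m = 0 ∨ m = 1 := by omega
        · have := three_le_card (empty_mem_sumFiber f s) (mem_sumFiber_of_mem_minZeroIndices hV)
            (mem_sumFiber_of_mem_minZeroIndices hW) hVm.1.ne_empty.symm hWm.1.ne_empty.symm hVW
          rw [hs.2] at this
          omega
        · exact disjoint_of_isTight_two hodd hs hV hW hVW
      rw [Finset.disjoint_left]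
      intro a haV haW
      have herase : ∀ t ∈ minZeroIndices f s, ∀ x ∈ t, IsTight f (s.erase x) m :=
        fun t ht x hx => hs.erase hx (mem_minZeroIndices.1 ht).1 (mem_minZeroIndices.1 ht).2.2.1
      have hpair : ∀ t ∈ minZeroIndices f s, ∀ x ∈ t, ∀ P ∈ minZeroIndices f s,
          ∀ Q ∈ minZeroIndices f s, x ∉ P → x ∉ Q → P ≠ Q → Disjoint P Q :=
        fun t ht x hx P hP Q hQ hxP hxQ hPQ => (ih _ (herase t ht x hx)).2
          (mem_minZeroIndices_erase.2 ⟨hP, hxP⟩) (mem_minZeroIndices_erase.2 ⟨hQ, hxQ⟩) hPQ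
      obtain ⟨T₁, hT₁, T₂, hT₂, hT⟩ := Finset.one_lt_card.1
        (show 1 < (minZeroIndices f (s.erase a)).card by
          rw [(ih _ (herase V hV a haV)).1]; omega)
      obtain ⟨hT₁, haT₁⟩ := mem_minZeroIndices_erase.1 hT₁
      obtain ⟨hT₂, haT₂⟩ := mem_minZeroIndices_erase.1 hT₂
      have hT₁₂ : Disjoint T₁ T₂ := hpair V hV a haV T₁ hT₁ T₂ hT₂ haT₁ haT₂ hT
      obtain ⟨b, hb⟩ := (mem_minZeroIndices.1 hT₁).2.1
      have hbT₂ : b ∉ T₂ := Finset.disjoint_left.1 hT₁₂ hb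
      have hU : ∃ R ∈ sumFiber f s 0, a ∈ R ∧ b ∉ R := by
        by_contra! hc
        have hsub : sumFiber f (s.erase b) 0 ⊆ sumFiber f (s.erase a) 0 := by
          intro R hR
          obtain ⟨h1, h2⟩ := mem_sumFiber_erase.1 hR
          exact mem_sumFiber_erase.2 ⟨h1, fun h => h2 (hc R h1 h)⟩
        have heq := Finset.eq_of_subset_of_card_le hsub
          (by rw [(herase V hV a haV).2, (herase T₁ hT₁ b hb).2])
        have : T₁ ∈ sumFiber f (s.erase a) 0 :=
          mem_sumFiber_erase.2 ⟨mem_sumFiber_of_mem_minZeroIndices hT₁, haT₁⟩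
        rw [← heq] at this
        exact (mem_sumFiber_erase.1 this).2 hb
      obtain ⟨R, hR, haR, hbR⟩ := hU
      obtain ⟨U, hUR, haU, hUm⟩ := exists_isMinZeroIndex_mem (mem_sumFiber.1 hR).2 haR
      have hUs : U ∈ minZeroIndices f s :=
        mem_minZeroIndices.2 ⟨hUR.trans (mem_sumFiber.1 hR).1, hUm⟩
      have hUT₂ : Disjoint U T₂ := hpair T₁ hT₁ b hb U hUs T₂ hT₂ (fun h => hbR (hUR h)) hbT₂
        (fun e => haT₂ (e ▸ haU))
      have huniq : ∀ P ∈ minZeroIndices f s, a ∈ P → P = U := by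
        intro P hP haP
        obtain ⟨x, hx, hxP⟩ : ∃ x ∈ T₂, x ∉ P := by
          by_contra! hc
          exact haT₂ ((mem_minZeroIndices.1 hP).2.eq_of_subset
            (mem_minZeroIndices.1 hT₂).2 hc ▸ haP)
        by_contra hPU
        exact Finset.disjoint_left.1 (hpair T₂ hT₂ x hx P hP U hUs hxP
          (Finset.disjoint_right.1 hUT₂ hx) hPU) haP haU
      exact hVW ((huniq V hV haV).trans (huniq W hW haW).symm)
    refine ⟨?_, hdisj⟩
    obtain ⟨t, ht, ⟨a, ha⟩, h0⟩ := exists_zero_sum_index f s (by have := hs.1; omega)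
    obtain ⟨V, hVt, haV, hVm⟩ := exists_isMinZeroIndex_mem h0 ha
    have hV : V ∈ minZeroIndices f s := mem_minZeroIndices.2 ⟨hVt.trans ht, hVm⟩
    have he : minZeroIndices f (s.erase a) = (minZeroIndices f s).erase V := by
      ext P
      rw [mem_minZeroIndices_erase, Finset.mem_erase, and_comm]
      refine and_congr_left fun hP => ⟨fun h e => h (e ▸ haV), fun h haP => ?_⟩
      exact Finset.disjoint_left.1 (hdisj hP hV h) haP haV
    rw [← Finset.card_erase_add_one hV, ← he, (ih _ (hs.erase ha ht h0)).1]

omit [DecidableEq G] in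
/-- If no term vanishes and minimal index sets are disjoint, then an index outside a minimal index
set never carries the same term as an index inside. -/
theorem mem_of_map_eq_of_pairwise_disjoint {f : ι → G} {s t : Finset ι}
    (hf : ∀ i ∈ s, f i ≠ 0)
    (hdisj : (minZeroIndices f s : Set (Finset ι)).Pairwise Disjoint)
    (ht : t ∈ minZeroIndices f s) {i j : ι} (hi : i ∈ t) (hj : j ∈ s) (hij : f i = f j) :
    j ∈ t := by
  by_contra hjt
  obtain ⟨hts, -, ht0, -⟩ := mem_minZeroIndices.1 ht
  have hjn : j ∉ t.erase i := fun h => hjt (Finset.mem_of_mem_erase h)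
  have h0 : ∑ k ∈ insert j (t.erase i), f k = 0 := by
    rw [Finset.sum_insert hjn, ← hij, Finset.add_sum_erase t f hi, ht0]
  obtain ⟨u, hu, hju, hum⟩ := exists_isMinZeroIndex_mem h0 (Finset.mem_insert_self j _)
  have hus : u ∈ minZeroIndices f s := mem_minZeroIndices.2
    ⟨hu.trans (Finset.insert_subset hj ((Finset.erase_subset _ _).trans hts)), hum⟩
  have hd : Disjoint u t := hdisj hus ht fun e => hjt (e ▸ hju)
  have huj : u = {j} := by
    refine Finset.eq_singleton_iff_unique_mem.2 ⟨hju, fun k hk => ?_⟩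
    by_contra hkj
    exact Finset.disjoint_left.1 hd hk
      (Finset.mem_of_mem_erase (Finset.mem_of_mem_insert_of_ne (hu hk) hkj))
  exact hf j hj (by simpa [huj] using hum.2.1)

omit [DecidableEq ι] [DecidableEq G] in
theorem isMinZeroSum_map_iff {f : ι → G} {t : Finset ι} :
    IsMinZeroSum (t.val.map f) ↔ IsMinZeroIndex f t := by
  constructor
  · rintro ⟨h1, h2, h3⟩
    refine ⟨?_, h2, fun u hu hne hu0 => ?_⟩
    · rw [Finset.nonempty_iff_ne_empty]
      rintro rfl
      simp at h1
    · by_contra hut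
      refine h3 (u.val.map f) (Multiset.map_le_map (Finset.val_le_iff.2 hu))
        (by simpa using hne.ne_empty) (fun e => hut ?_) hu0
      refine Finset.eq_of_subset_of_card_le hu ?_
      have := congrArg Multiset.card e
      simp only [Multiset.card_map, Finset.card_val] at this
      exact this.ge
  · rintro ⟨h1, h2, h3⟩
    refine ⟨by simpa using h1.ne_empty, h2, fun U hU hne hUt hU0 => ?_⟩
    obtain ⟨u, hu, rfl⟩ := Finset.exists_subset_map_eq hU
    have hune : u.Nonempty := by
      rw [Finset.nonempty_iff_ne_empty]
      rintro rfl
      simp at hne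
    exact hUt (by rw [h3 u hu hune hU0])

omit [DecidableEq ι] in
theorem nSub_map (f : ι → G) (s : Finset ι) (g : G) :
    NSub (s.val.map f) g = (sumFiber f s g).card := by
  have hp : s.powerset.val.map Finset.val = s.val.powerset := by
    rw [Finset.powerset, Multiset.map_pmap]
    exact (Multiset.pmap_eq_map _ id _ _).trans (Multiset.map_id _)
  rw [NSub, Multiset.powerset_map_eq, ← hp, Multiset.map_map, Multiset.filter_map,
    Multiset.card_map, sumFiber, Finset.card_def, Finset.filter_val]
  rfl

omit [DecidableEq ι] [DecidableEq G] in
theorem setOf_isMinZeroSum_map (f : ι → G) (s : Finset ι) :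
    {T : Multiset G | T ≤ s.val.map f ∧ IsMinZeroSum T} =
      Set.image (fun t : Finset ι => t.val.map f) (minZeroIndices f s) := by
  ext T
  simp only [Set.mem_ofPred_eq, Set.mem_image, Finset.mem_coe, mem_minZeroIndices]
  constructor
  · rintro ⟨hT, hm⟩
    obtain ⟨t, ht, rfl⟩ := Finset.exists_subset_map_eq hT
    exact ⟨t, ⟨ht, isMinZeroSum_map_iff.1 hm⟩, rfl⟩
  · rintro ⟨t, ⟨ht, hm⟩, rfl⟩
    exact ⟨Multiset.map_le_map (Finset.val_le_iff.2 ht), isMinZeroSum_map_iff.2 hm⟩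

end Index

theorem stmt9 {G : Type*} [AddCommGroup G] [Fintype G] [DecidableEq G]
    (hodd : Odd (Fintype.card G))
    (S : Multiset G) (h0 : (0 : G) ∉ S)
    (hlen : Davenport G - 1 ≤ Multiset.card S)
    (hN : NSub S 0 = 2 ^ (Multiset.card S + 1 - Davenport G)) :
    {T : Multiset G | T ≤ S ∧ IsMinZeroSum T}.ncard
        = Multiset.card S + 1 - Davenport G ∧
    {T : Multiset G | T ≤ S ∧ IsMinZeroSum T}.Pairwise
        (fun T₁ T₂ => T₁ ∩ T₂ = 0) := by
  obtain ⟨s, f, rfl⟩ : ∃ (s : Finset (G × ℕ)) (f : G × ℕ → G), s.val.map f = S :=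
    ⟨S.toEnumFinset, Prod.fst, Multiset.map_toEnumFinset_fst S⟩
  have hf : ∀ i ∈ s, f i ≠ 0 := fun i hi h => h0 (Multiset.mem_map.2 ⟨i, hi, h⟩)
  have hD := (davenport_spec G).1
  rw [nSub_map] at hN
  simp only [Multiset.card_map, Finset.card_val] at hlen hN ⊢
  obtain ⟨hcard, hdisj⟩ :=
    card_minZeroIndices_of_isTight hodd f _ s ⟨by omega, hN⟩
  have hinter : ∀ t ∈ minZeroIndices f s, ∀ u ∈ minZeroIndices f s, t ≠ u →
      t.val.map f ∩ u.val.map f = 0 := by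
    intro t ht u hu htu
    rw [Multiset.eq_zero_iff_forall_notMem]
    intro x hx
    obtain ⟨hxt, hxu⟩ := Multiset.mem_inter.1 hx
    obtain ⟨i, hi, rfl⟩ := Multiset.mem_map.1 hxt
    obtain ⟨j, hj, hji⟩ := Multiset.mem_map.1 hxu
    exact Finset.disjoint_left.1 (hdisj ht hu htu) (mem_of_map_eq_of_pairwise_disjoint hf hdisj ht
      hi ((mem_minZeroIndices.1 hu).1 hj) hji.symm) hj
  rw [setOf_isMinZeroSum_map]
  constructor
  · rw [Set.InjOn.ncard_image, Set.ncard_coe_finset, hcard]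
    intro t ht u hu h
    by_contra htu
    have h1 := hinter t ht u hu htu
    simp only at h
    rw [← h] at h1
    replace h1 := (inf_idem (t.val.map f)).symm.trans h1
    exact (mem_minZeroIndices.1 ht).2.1.ne_empty (by simpa using h1)
  · rintro _ ⟨t, ht, rfl⟩ _ ⟨u, hu, rfl⟩ h
    exact hinter t ht u hu fun e => h (by rw [e])
end

section
/- Let G be a finite abelian group such that D(G) ≥ D(G/H) + 2 for every subgroup H of G isomorphic to C_2. Then for every sequence S over G with |S| ≥ D(G) − 1, the set E(S) contains no non-trivial subgroup of G. -/
section Subsums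

variable {G : Type*} [AddCommGroup G]

section NSub

variable [DecidableEq G]

theorem NSub_empty (g : G) : NSub (0 : Multiset G) g = if g = 0 then 1 else 0 := by
  by_cases h : g = 0 <;> simp [NSub, Multiset.filter_singleton, h, Ne.symm]

theorem NSub_cons (a : G) (S : Multiset G) (g : G) :
    NSub (a ::ₘ S) g = NSub S g + NSub S (g - a) := by
  unfold NSub
  rw [Multiset.powerset_cons, Multiset.filter_add, Multiset.card_add, Multiset.filter_map,
    Multiset.card_map]
  congr 2
  refine Multiset.filter_congr fun T _ => ?_
  simp [eq_sub_iff_add_eq, add_comm]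

theorem NSub_add_map_neg (T R : Multiset G) (x : G) :
    NSub (T.map (fun a => -a) + R) x = NSub (T + R) (x + T.sum) := by
  induction T using Multiset.induction generalizing x with
  | empty => simp
  | cons a T ih =>
    simp only [Multiset.map_cons, Multiset.cons_add, NSub_cons, ih, Multiset.sum_cons]
    rw [add_comm]
    congr 2 <;> abel

theorem NSub_pos_of_le {S T : Multiset G} (h : T ≤ S) : 0 < NSub S T.sum :=
  Multiset.card_pos_iff_exists_mem.2 ⟨T, by simpa using h⟩

theorem NSub_map {G' : Type*} [AddCommGroup G'] [DecidableEq G'] [Fintype G] (f : G →+ G')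
    (S : Multiset G) (y : G') :
    NSub (S.map f) y = ∑ g with f g = y, NSub S g := by
  induction S using Multiset.induction generalizing y with
  | empty => simp [NSub_empty, eq_comm]
  | cons a S ih =>
    simp only [Multiset.map_cons, NSub_cons, Finset.sum_add_distrib, ih]
    congr 1
    refine Finset.sum_bij' (fun g _ => g + a) (fun g _ => g - a) ?_ ?_ ?_ ?_ ?_ <;>
      simp +contextual

end NSub

section Davenport

theorem exists_le_sum_eq_zero [Fintype G] (S : Multiset G)
    (hS : Fintype.card G * Fintype.card G < Multiset.card S) :
    ∃ T ≤ S, T ≠ 0 ∧ T.sum = 0 := by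
  classical
  by_contra! h
  have hc (g : G) : S.count g ≤ Fintype.card G := by
    by_contra! hg
    have := h (Multiset.replicate (addOrderOf g) g)
      (Multiset.le_count_iff_replicate_le.1 (addOrderOf_le_card_univ.trans hg.le))
      (by
        rw [← Multiset.card_pos, Multiset.card_replicate]
        exact addOrderOf_pos g)
    simp [addOrderOf_nsmul_eq_zero] at this
  have : Multiset.card S = ∑ g, S.count g :=
    (Multiset.sum_count_eq_card fun a _ => Finset.mem_univ a).symm
  have h2 := Finset.sum_le_card_nsmul Finset.univ (fun g => S.count g) _ fun g _ => hc g
  simp only [Finset.card_univ, smul_eq_mul] at h2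
  omega

variable (G) in
theorem Davenport_spec [Finite G] : 0 < Davenport G ∧ ∀ S : Multiset G,
    Davenport G ≤ Multiset.card S → ∃ T : Multiset G, T ≤ S ∧ T ≠ 0 ∧ T.sum = 0 := by
  have := Fintype.ofFinite G
  exact Nat.sInf_mem (s := {ℓ : ℕ | 0 < ℓ ∧ ∀ S : Multiset G, ℓ ≤ Multiset.card S →
    ∃ T : Multiset G, T ≤ S ∧ T ≠ 0 ∧ T.sum = 0})
    ⟨_, Nat.succ_pos _, fun S hS => exists_le_sum_eq_zero S hS⟩

theorem card_lt_Davenport [Finite G] {S : Multiset G}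
    (hS : ∀ T ≤ S, T.sum = 0 → T = 0) : Multiset.card S < Davenport G := by
  by_contra! h
  obtain ⟨T, hT, hT0, hs⟩ := (Davenport_spec G).2 S h
  exact hT0 (hS T hT hs)

variable (G) in
theorem exists_Davenport_le_card_add_one :
    ∃ S : Multiset G, Davenport G ≤ Multiset.card S + 1 ∧ ∀ T ≤ S, T.sum = 0 → T = 0 := by
  by_contra! h
  by_cases hD : Davenport G ≤ 1
  · obtain ⟨T, hT, -, hT0⟩ := h 0 (by simpa using hD)
    exact hT0 (by simpa using hT)
  · refine Nat.notMem_of_lt_sInf (show Davenport G - 1 < Davenport G by omega)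
      ⟨by omega, fun S hS => ?_⟩
    obtain ⟨T, hT, hs, hT0⟩ := h S (by omega)
    exact ⟨T, hT, hT0, hs⟩

/-- Olson's lower bound for the number of zero-sum subsequences. -/
theorem two_pow_le_NSub_zero [Finite G] [DecidableEq G] (S : Multiset G) :
    2 ^ (Multiset.card S + 1 - Davenport G) ≤ NSub S 0 := by
  induction h : Multiset.card S generalizing S with
  | zero =>
    have := (Davenport_spec G).1
    rw [Multiset.card_eq_zero.1 h, NSub_empty, if_pos rfl,
      show 0 + 1 - Davenport G = 0 by omega, pow_zero]
  | succ n ih =>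
    by_cases hn : Davenport G ≤ n + 1
    · obtain ⟨T, hT, hT0, hs⟩ := (Davenport_spec G).2 S (h ▸ hn)
      obtain ⟨R, rfl⟩ := Multiset.le_iff_exists_add.1 hT
      obtain ⟨a, ha⟩ := Multiset.exists_mem_of_ne_zero hT0
      obtain ⟨T, rfl⟩ := Multiset.exists_cons_of_mem ha
      have h1 := ih (T + R) (by simpa using h)
      have h2 := ih (T.map (fun a => -a) + R) (by simpa using h)
      rw [NSub_add_map_neg] at h2
      rw [Multiset.sum_cons] at hs
      rw [Multiset.cons_add, NSub_cons, zero_sub, neg_eq_of_add_eq_zero_right hs,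
        show n + 1 + 1 - Davenport G = n + 1 - Davenport G + 1 by omega, pow_succ]
      rw [zero_add] at h2
      omega
    · rw [show n + 1 + 1 - Davenport G = 0 by omega, pow_zero]
      exact NSub_pos_of_le (T := 0) (Multiset.zero_le S)

theorem Davenport_quotient_zmultiples_add_le [Finite G] (g : G) :
    Davenport (G ⧸ AddSubgroup.zmultiples g) + (addOrderOf g - 1) ≤ Davenport G := by
  classical
  obtain ⟨Q, hQ, hQ0⟩ := exists_Davenport_le_card_add_one (G ⧸ AddSubgroup.zmultiples g)
  have key : ∀ T ≤ Q.map Quotient.out + Multiset.replicate (addOrderOf g - 1) g,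
      T.sum = 0 → T = 0 := by
    intro T hT hs
    obtain ⟨T₁, T₂, h₁, h₂, rfl⟩ : ∃ T₁ T₂, T₁ ≤ Q.map Quotient.out ∧
        T₂ ≤ Multiset.replicate (addOrderOf g - 1) g ∧ T₁ + T₂ = T :=
      ⟨T - Multiset.replicate (addOrderOf g - 1) g, T ∩ Multiset.replicate (addOrderOf g - 1) g,
        Multiset.sub_le_iff_le_add.2 hT, Multiset.inter_le_right, Multiset.sub_add_inter _ _⟩
    obtain ⟨k, hk, rfl⟩ := Multiset.le_replicate_iff.1 h₂
    have hT₁ : T₁ = 0 := by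
      have hm := Multiset.map_le_map (f := QuotientAddGroup.mk' (AddSubgroup.zmultiples g)) h₁
      rw [Multiset.map_map] at hm
      have hid :
          Q.map (QuotientAddGroup.mk' (AddSubgroup.zmultiples g) ∘ Quotient.out) = Q := by
        conv_rhs => rw [← Multiset.map_id Q]
        exact Multiset.map_congr rfl fun q _ => QuotientAddGroup.out_eq' q
      rw [hid] at hm
      refine Multiset.map_eq_zero.1 (hQ0 _ hm ?_)
      rw [← map_multiset_sum, QuotientAddGroup.mk'_apply, QuotientAddGroup.eq_zero_iff]
      rw [Multiset.sum_add, Multiset.sum_replicate] at hs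
      rw [eq_neg_of_add_eq_zero_left hs]
      exact neg_mem (AddSubgroup.nsmul_mem_zmultiples g k)
    subst hT₁
    have hk0 : k = 0 := by
      by_contra hne
      have hle := addOrderOf_le_of_nsmul_eq_zero (Nat.pos_of_ne_zero hne)
        (by simpa using hs : k • g = 0)
      omega
    simp [hk0]
  have := card_lt_Davenport key
  simp only [Multiset.card_add, Multiset.card_map, Multiset.card_replicate] at this
  omega

/-- If a finite subgroup `H` is contained in `ESet S`, Olson's bound in `G ⧸ H` limits
the gap between the Davenport constants. -/
theorem two_pow_le_card_of_subset_ESet [Fintype G] [DecidableEq G] {S : Multiset G}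
    (hS : Davenport G - 1 ≤ Multiset.card S) {H : AddSubgroup G} (hH : (H : Set G) ⊆ ESet S)
    {k : ℕ} (hk : Davenport (G ⧸ H) + k ≤ Davenport G) : 2 ^ k ≤ Nat.card H := by
  classical
  have h := two_pow_le_NSub_zero (S.map (QuotientAddGroup.mk' H))
  rw [NSub_map, Finset.sum_congr rfl (g := fun _ => 2 ^ (Multiset.card S + 1 - Davenport G))
    (fun g hg => hH (by simpa using hg)), Finset.sum_const, Multiset.card_map, smul_eq_mul] at h
  have hc : (Finset.univ.filter fun g => QuotientAddGroup.mk' H g = 0).card = Nat.card H := by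
    rw [Nat.card_eq_fintype_card, Fintype.card_subtype]
    congr with g
    exact QuotientAddGroup.eq_zero_iff g
  rw [hc] at h
  have h3 : 2 ^ (k + (Multiset.card S + 1 - Davenport G)) ≤
      Nat.card H * 2 ^ (Multiset.card S + 1 - Davenport G) :=
    (Nat.pow_le_pow_right two_pos (by omega)).trans h
  rw [pow_add] at h3
  exact Nat.le_of_mul_le_mul_right h3 (by positivity)

end Davenport

end Subsums

theorem stmt13 {G : Type*} [AddCommGroup G] [Fintype G] [DecidableEq G]
    (hyp : ∀ H : AddSubgroup G, Nonempty (H ≃+ ZMod 2) →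
      Davenport (G ⧸ H) + 2 ≤ Davenport G) :
    ∀ S : Multiset G, Davenport G - 1 ≤ Multiset.card S →
      ∀ H : AddSubgroup G, H ≠ ⊥ → ¬ ((H : Set G) ⊆ ESet S) := by
  intro S hS H hH hE
  have := AddSubgroup.nontrivial_iff_ne_bot H |>.2 hH
  obtain ⟨p, hp, hpd⟩ := Nat.exists_prime_and_dvd (Finite.one_lt_card (α := H)).ne'
  have := Fact.mk hp
  obtain ⟨⟨g, hgH⟩, hg⟩ := exists_prime_addOrderOf_dvd_card' p hpd
  rw [AddSubgroup.addOrderOf_mk] at hg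
  have hsub : (AddSubgroup.zmultiples g : Set G) ⊆ ESet S :=
    fun x hx => hE (AddSubgroup.zmultiples_le_of_mem hgH hx)
  have hcard : Nat.card (AddSubgroup.zmultiples g) = p := by rw [Nat.card_zmultiples, hg]
  have key := @two_pow_le_card_of_subset_ESet G _ _ _ S hS _ hsub
  rw [hcard] at key
  rcases hp.eq_two_or_odd' with rfl | hodd
  · exact absurd (key (hyp _ ⟨(zmodAddCyclicAddEquiv inferInstance).symm.trans
      (ZMod.ringEquivCongr hcard).toAddEquiv⟩)) (by norm_num)
  · have h1 := key (hg ▸ Davenport_quotient_zmultiples_add_le g)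
    obtain ⟨m, rfl⟩ := hodd
    have h2 : 1 ≤ m := by
      have := hp.two_le
      omega
    rw [Nat.add_sub_cancel, pow_mul] at h1
    have h3 := Nat.lt_pow_self (show 1 < 2 by norm_num) (n := m)
    have h4 : (2 ^ 2) ^ m = 2 ^ m * 2 ^ m := by rw [← pow_mul, two_mul, pow_add]
    nlinarith
end
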